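/- Let m ≥ 1 and p ≥ 0 be integers, b_j ∈ ℝ, β_j > 0 with b_j + β_j > 0 for 1 ≤ j ≤ m, a_i ∈ ℝ, α_i > 0 with a_i + α_i > 0 for 1 ≤ i ≤ p, and suppose 0 < Σ_{j=1}^m β_j − Σ_{i=1}^p α_i < 1 (i.e. Δ > 0 and Σ α_i − Σ β_j > −1). Let γ > max_{1≤j≤m}(−b_j/β_j), define H(x) = (1/(2π)) ∫_{t∈ℝ} [Π_{j=1}^m Γ(b_j+β_j(γ+it)) / Π_{i=1}^p Γ(a_i+α_i(γ+it))] x^{−(γ+it)} dt for x > 0, and assume H is real and nonnegative on (0,∞). Set K = Π_{j=1}^m Γ(b_j+β_j) / Π_{i=1}^p Γ(a_i+α_i) and ρ = H/K. Then the power series z ↦ (1/K) Σ_{k=0}^∞ [Π_{j=1}^m Γ(b_j+β_j(1+k)) / Π_{i=1}^p Γ(a_i+α_i(1+k))] z^k/k! converges for every z ∈ ℂ, and for every s ≥ 0 the Laplace transform satisfies ∫₀^∞ e^{−sx} ρ(x) dx = (1/K) Σ_{k=0}^∞ [Π_{j=1}^m Γ(b_j+β_j(1+k)) / Π_{i=1}^p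 Γ(a_i+α_i(1+k))] (−s)^k/k!. -/

import Mathlib

open MeasureTheory Finset Filter Complex Real

/-- The Fox-H kernel of type `(m,0;p,m)`: `𝓗(s) = ∏_{j<m} Γ(bⱼ+βⱼs) / ∏_{i<p} Γ(aᵢ+αᵢs)`. -/
noncomputable def foxKernelM (m p : ℕ) (a α b β : ℕ → ℝ) (s : ℂ) : ℂ :=
  (∏ j ∈ Finset.range m, Complex.Gamma (b j + β j * s)) /
  (∏ i ∈ Finset.range p, Complex.Gamma (a i + α i * s))

/-- The corresponding Fox-H function on `(0,∞)` defined by the vertical contour `L_{iγ∞}`. -/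
noncomputable def foxHposM (m p : ℕ) (a α b β : ℕ → ℝ) (γ : ℝ) (x : ℝ) : ℂ :=
  (1 / (2 * π)) * ∫ t : ℝ, foxKernelM m p a α b β ((γ : ℂ) + (t : ℂ) * Complex.I) *
    Complex.exp (-((γ : ℂ) + (t : ℂ) * Complex.I) * (Real.log x : ℂ))

theorem Complex.norm_betaIntegral_le (u v : ℂ) :
    ‖Complex.betaIntegral u v‖ ≤ ‖Complex.betaIntegral u.re v.re‖ := by
  have h : Complex.betaIntegral u.re v.re
      = ((∫ x in (0 : ℝ)..1, x ^ (u.re - 1) * (1 - x) ^ (v.re - 1) : ℝ) : ℂ) := by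
    rw [Complex.betaIntegral, ← intervalIntegral.integral_ofReal]
    refine intervalIntegral.integral_congr fun x hx ↦ ?_
    rw [Set.uIcc_of_le zero_le_one] at hx
    have h1 : 0 ≤ 1 - x := by linarith [hx.2]
    push_cast [Complex.ofReal_cpow hx.1, Complex.ofReal_cpow h1]
    rfl
  rw [h, Complex.norm_real, Complex.betaIntegral]
  refine (intervalIntegral.norm_integral_le_integral_norm zero_le_one).trans
    ((le_of_eq ?_).trans (le_abs_self _))
  refine intervalIntegral.integral_congr_Ioo_of_le zero_le_one fun x hx ↦ ?_
  have h1 : 0 < 1 - x := by linarith [hx.2]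
  have := Complex.norm_cpow_eq_rpow_re_of_pos h1 (v - 1)
  push_cast at this
  simp [Complex.norm_cpow_eq_rpow_re_of_pos hx.1, this]

/-- The ratio `‖Γ z‖ / Γ (re z)` is monotone along horizontal lines. -/
theorem Complex.norm_Gamma_mul_Gamma_re_add_le {z : ℂ} (hz : 0 < z.re) {d : ℝ} (hd : 0 < d) :
    ‖Complex.Gamma z‖ * Real.Gamma (z.re + d) ≤ Real.Gamma z.re * ‖Complex.Gamma (z + d)‖ := by
  have h1 := congrArg norm (Complex.Gamma_mul_Gamma_eq_betaIntegral hz (t := (d : ℂ)) (by simpa))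
  have h2 := congrArg norm (Complex.Gamma_mul_Gamma_eq_betaIntegral
    (s := (z.re : ℂ)) (t := (d : ℂ)) (by simpa) (by simpa))
  have h3 := Complex.norm_betaIntegral_le z d
  rw [← Complex.ofReal_add] at h2
  simp only [norm_mul, Complex.Gamma_ofReal, Complex.norm_real, Complex.ofReal_re,
    Real.norm_of_nonneg (Real.Gamma_pos_of_pos hz).le,
    Real.norm_of_nonneg (Real.Gamma_pos_of_pos hd).le,
    Real.norm_of_nonneg (Real.Gamma_pos_of_pos (add_pos hz hd)).le] at h1 h2 h3
  refine le_of_mul_le_mul_right ?_ (Real.Gamma_pos_of_pos hd)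
  calc ‖Complex.Gamma z‖ * Real.Gamma (z.re + d) * Real.Gamma d
      = ‖Complex.Gamma (z + d)‖ * (Real.Gamma (z.re + d) * ‖Complex.betaIntegral z d‖) := by
        linear_combination Real.Gamma (z.re + d) * h1
    _ ≤ ‖Complex.Gamma (z + d)‖ *
        (Real.Gamma (z.re + d) * ‖Complex.betaIntegral z.re d‖) := by
        have := Real.Gamma_pos_of_pos (add_pos hz hd)
        gcongr
    _ = Real.Gamma z.re * ‖Complex.Gamma (z + d)‖ * Real.Gamma d := by
        rw [← h2]; ring

theorem Complex.norm_Gamma_half_add_mul_I_le (y : ℝ) :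
    ‖Complex.Gamma (1 / 2 + y * I)‖ ≤ √(2 * π) * Real.exp (-(π / 2) * |y|) := by
  have hconj : Complex.Gamma (1 - (1 / 2 + y * I))
      = (starRingEnd ℂ) (Complex.Gamma (1 / 2 + y * I)) := by
    rw [← Complex.Gamma_conj]
    congr 1
    apply Complex.ext <;> simp
    norm_num
  have h := congrArg norm (Complex.Gamma_mul_Gamma_one_sub (1 / 2 + y * I))
  have hsin : Complex.sin (π * (1 / 2 + y * I)) = (Real.cosh (π * y) : ℂ) := by
    have : (π : ℂ) * (1 / 2 + y * I) = (π * y : ℝ) * I + π / 2 := by push_cast; ring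
    rw [this, Complex.sin_add_pi_div_two, Complex.cos_mul_I, Complex.ofReal_cosh]
  rw [hconj, hsin, norm_mul, RCLike.norm_conj, norm_div, Complex.norm_real, Complex.norm_real,
    Real.norm_of_nonneg pi_pos.le, Real.norm_of_nonneg (Real.cosh_pos _).le] at h
  have hcosh : Real.exp (π * |y|) / 2 ≤ Real.cosh (π * y) := by
    rw [← Real.cosh_abs, abs_mul, abs_of_pos pi_pos, Real.cosh_eq]
    have := Real.exp_pos (-(π * |y|))
    linarith
  refine abs_le_of_sq_le_sq' (a := ‖_‖) ?_ (by positivity) |>.2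
  rw [sq, h, mul_pow, Real.sq_sqrt (by positivity), ← Real.exp_nat_mul, div_le_iff₀ (by positivity)]
  calc π = 2 * π * Real.exp (-(π * |y|)) * (Real.exp (π * |y|) / 2) := by
        rw [Real.exp_neg]; field_simp
    _ ≤ 2 * π * Real.exp (-(π * |y|)) * Real.cosh (π * y) := by gcongr
    _ = _ := by congr 3; push_cast; ring

theorem Complex.norm_Gamma_nat_add_half_add_mul_I_le (n : ℕ) (y : ℝ) :
    ‖Complex.Gamma (n + 1 / 2 + y * I)‖
      ≤ √(2 * π) * (n + |y|) ^ n * Real.exp (-(π / 2) * |y|) := by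
  induction n with
  | zero => simpa using Complex.norm_Gamma_half_add_mul_I_le y
  | succ n ih =>
    have hne : (n + 1 / 2 + y * I : ℂ) ≠ 0 := fun h ↦ by
      have := congrArg Complex.re h
      simp at this
      linarith [(n.cast_nonneg : (0 : ℝ) ≤ n)]
    have : ((n + 1 : ℕ) + 1 / 2 + y * I : ℂ) = (n + 1 / 2 + y * I) + 1 := by push_cast; ring
    rw [this, Complex.Gamma_add_one _ hne, norm_mul]
    have h1 : ‖(n + 1 / 2 + y * I : ℂ)‖ ≤ (n + 1 : ℕ) + |y| := by
      refine (norm_add_le _ _).trans ?_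
      have : (n + 1 / 2 : ℂ) = ((n + 1 / 2 : ℝ) : ℂ) := by push_cast; ring
      rw [this, Complex.norm_real, Real.norm_of_nonneg (by positivity)]
      simp
      norm_num
    have h2 : (n + |y|) ^ n ≤ ((n + 1 : ℕ) + |y|) ^ n := by
      gcongr; simp
    calc _ ≤ ((n + 1 : ℕ) + |y|) * (√(2 * π) * ((n + 1 : ℕ) + |y|) ^ n *
          Real.exp (-(π / 2) * |y|)) := by
          refine mul_le_mul h1 (ih.trans ?_) (norm_nonneg _) (by positivity)
          gcongr
      _ = _ := by ring

theorem exists_add_abs_pow_le_exp (n : ℕ) {ε : ℝ} (hε : 0 < ε) :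
    ∃ C, 0 ≤ C ∧ ∀ y : ℝ, (n + |y|) ^ n ≤ C * Real.exp (ε * |y|) := by
  refine ⟨n.factorial / ε ^ n * Real.exp (ε * n), by positivity, fun y ↦ ?_⟩
  have h := Real.pow_div_factorial_le_exp (ε * (n + |y|)) (by positivity) n
  rw [div_le_iff₀ (by positivity), mul_pow, mul_add, Real.exp_add] at h
  rw [mul_assoc, div_mul_eq_mul_div, le_div_iff₀ (by positivity)]
  linarith

theorem Complex.exists_norm_Gamma_le_exp {θ σ₁ σ₂ : ℝ} (hθ : θ < π / 2) (h₁ : 0 < σ₁) :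
    ∃ C, 0 ≤ C ∧ ∀ z : ℂ, z.re ∈ Set.Icc σ₁ σ₂ →
      ‖Complex.Gamma z‖ ≤ C * Real.exp (-θ * |z.im|) := by
  obtain ⟨n, hn⟩ := exists_nat_gt σ₂
  obtain ⟨A, hA, hpow⟩ := exists_add_abs_pow_le_exp n (sub_pos.2 hθ)
  have hcont : ContinuousOn Real.Gamma (Set.Icc σ₁ σ₂) := fun x hx ↦
    (Real.differentiableAt_Gamma fun k ↦ by
      have := h₁.trans_le hx.1
      have : (0 : ℝ) ≤ k := k.cast_nonneg
      linarith).continuousAt.continuousWithinAt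
  obtain ⟨B, hB⟩ := isCompact_Icc.exists_bound_of_continuousOn hcont
  have hG : 0 < Real.Gamma (n + 1 / 2) := Real.Gamma_pos_of_pos (by positivity)
  refine ⟨|B| / Real.Gamma (n + 1 / 2) * (√(2 * π) * A), by positivity, fun z hz ↦ ?_⟩
  have hpos := h₁.trans_le hz.1
  have h := Complex.norm_Gamma_mul_Gamma_re_add_le hpos (d := n + 1 / 2 - z.re)
    (by linarith [hz.2])
  have hz' : z + ((n + 1 / 2 - z.re : ℝ) : ℂ) = n + 1 / 2 + z.im * I := by
    apply Complex.ext <;> simp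
  rw [hz', add_sub_cancel] at h
  have h3 := Complex.norm_Gamma_nat_add_half_add_mul_I_le n z.im
  have h4 : Real.Gamma z.re ≤ |B| :=
    (le_abs_self _).trans ((hB _ hz).trans (le_abs_self _))
  rw [← le_div_iff₀ hG] at h
  refine h.trans ?_
  rw [mul_div_right_comm, mul_assoc]
  have h5 : ‖Complex.Gamma (n + 1 / 2 + z.im * I)‖ ≤
      √(2 * π) * A * Real.exp (-θ * |z.im|) := by
    refine h3.trans ?_
    calc _ ≤ √(2 * π) * (A * Real.exp ((π / 2 - θ) * |z.im|)) *
          Real.exp (-(π / 2) * |z.im|) := by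
          gcongr
          exact hpow _
      _ = √(2 * π) * A * (Real.exp ((π / 2 - θ) * |z.im|) *
          Real.exp (-(π / 2) * |z.im|)) := by ring
      _ = _ := by rw [← Real.exp_add]; congr 2; ring
  gcongr

theorem Complex.norm_sin_le_exp (z : ℂ) : ‖Complex.sin z‖ ≤ Real.exp |z.im| := by
  rw [Complex.sin, norm_div, norm_mul, Complex.norm_I, mul_one, Complex.norm_two,
    div_le_iff₀ two_pos]
  refine (norm_sub_le _ _).trans ?_
  rw [Complex.norm_exp, Complex.norm_exp]
  have h1 : Real.exp ((-z * I).re) ≤ Real.exp |z.im| := by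
    gcongr; simpa using le_abs_self _
  have h2 : Real.exp ((z * I).re) ≤ Real.exp |z.im| := by
    gcongr; simpa using neg_le_abs _
  linarith

theorem Complex.exists_norm_inv_Gamma_le_exp_of_lt_one {θ σ₁ σ₂ : ℝ} (hθ : θ < π / 2)
    (h₂ : σ₂ < 1) :
    ∃ C, 0 ≤ C ∧ ∀ z : ℂ, z.re ∈ Set.Icc σ₁ σ₂ →
      ‖(Complex.Gamma z)⁻¹‖ ≤ C * Real.exp ((π - θ) * |z.im|) := by
  obtain ⟨C, hC, h⟩ := Complex.exists_norm_Gamma_le_exp (σ₁ := 1 - σ₂) (σ₂ := 1 - σ₁) hθ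
    (by linarith)
  refine ⟨C / π, by positivity, fun z hz ↦ ?_⟩
  have hG := h (1 - z) (by
    simp only [Complex.sub_re, Complex.one_re, Set.mem_Icc, sub_le_sub_iff_left]
    exact hz.symm)
  have hs := Complex.norm_sin_le_exp (π * z)
  by_cases hz0 : Complex.Gamma z = 0
  · rw [hz0]; simp; positivity
  have hrefl := Complex.Gamma_mul_Gamma_one_sub z
  have hsin : Complex.sin (π * z) ≠ 0 := fun h0 ↦ by
    rw [h0, div_zero, mul_eq_zero, or_iff_right hz0] at hrefl
    refine Complex.Gamma_ne_zero_of_re_pos ?_ hrefl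
    simp; linarith [hz.2]
  have hinv : (Complex.Gamma z)⁻¹ = Complex.Gamma (1 - z) * Complex.sin (π * z) / π := by
    have : (π : ℂ) ≠ 0 := by exact_mod_cast pi_ne_zero
    rw [eq_div_iff hsin] at hrefl
    rw [inv_eq_iff_eq_inv, inv_div, eq_div_iff, ← mul_assoc, hrefl]
    exact fun h0 ↦ this (by rw [← hrefl, mul_assoc, h0, mul_zero])
  rw [hinv, norm_div, norm_mul, Complex.norm_real, Real.norm_of_nonneg pi_pos.le,
    div_mul_eq_mul_div]
  refine div_le_div_of_nonneg_right ?_ pi_pos.le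
  simp only [Complex.sub_im, Complex.one_im, zero_sub, abs_neg] at hG
  simp only [Complex.im_ofReal_mul, abs_mul, abs_of_pos pi_pos] at hs
  calc _ ≤ C * Real.exp (-θ * |z.im|) * Real.exp (π * |z.im|) := by gcongr
    _ = _ := by rw [mul_assoc, ← Real.exp_add]; congr 2; ring

theorem Complex.exists_norm_inv_Gamma_le_exp {θ : ℝ} (hθ : θ < π / 2) (σ₁ σ₂ : ℝ) :
    ∃ C, 0 ≤ C ∧ ∀ z : ℂ, z.re ∈ Set.Icc σ₁ σ₂ →
      ‖(Complex.Gamma z)⁻¹‖ ≤ C * Real.exp ((π - θ) * |z.im|) := by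
  obtain ⟨n, hn⟩ := exists_nat_gt (σ₂ - 1)
  replace hn : σ₂ < n + 1 := by linarith
  induction n generalizing σ₁ σ₂ with
  | zero => exact Complex.exists_norm_inv_Gamma_le_exp_of_lt_one hθ (by simpa using hn)
  | succ n ih =>
    obtain ⟨C, hC, h⟩ := ih (σ₁ - 1) (σ₂ - 1) (by push_cast at hn; linarith)
    obtain ⟨D, hD⟩ := ((isCompact_Icc (a := σ₁) (b := σ₂)).reProdIm
      (isCompact_Icc (a := (-1 : ℝ)) (b := 1))).exists_bound_of_continuousOn
      (f := fun z ↦ (Complex.Gamma z)⁻¹) Complex.differentiable_one_div_Gamma.continuous.continuousOn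
    have hE (y : ℝ) : 1 ≤ Real.exp ((π - θ) * |y|) :=
      Real.one_le_exp (mul_nonneg (by linarith [pi_pos]) (abs_nonneg y))
    refine ⟨max C |D|, le_max_of_le_left hC, fun z hz ↦ ?_⟩
    rcases le_total |z.im| 1 with hy | hy
    · calc _ ≤ |D| := (hD z ⟨hz, abs_le.1 hy⟩).trans (le_abs_self _)
        _ ≤ max C |D| * 1 := by simp
        _ ≤ _ := by gcongr; exact hE _
    · have hz1 : 1 ≤ ‖z - 1‖ := by
        refine hy.trans ?_
        simpa using Complex.abs_im_le_norm (z - 1)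
      have hne : z - 1 ≠ 0 := fun h0 ↦ by rw [h0, norm_zero] at hz1; linarith
      have hG := Complex.Gamma_add_one (z - 1) hne
      rw [sub_add_cancel] at hG
      rw [hG, mul_inv, norm_mul, norm_inv]
      have h3 := h (z - 1) (by simpa using hz)
      simp only [Complex.sub_im, Complex.one_im, sub_zero] at h3
      calc _ ≤ 1 * (C * Real.exp ((π - θ) * |z.im|)) := by
            gcongr
            exact inv_le_one_of_one_le₀ hz1
        _ ≤ _ := by rw [one_mul]; gcongr; exact le_max_left _ _

theorem integrable_exp_neg_mul_abs {δ : ℝ} (hδ : 0 < δ) :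
    Integrable fun t : ℝ ↦ Real.exp (-δ * |t|) := by
  rw [← integrableOn_univ, ← Set.Iic_union_Ioi (a := (0 : ℝ)), integrableOn_union]
  refine ⟨(integrableOn_exp_mul_Iic hδ 0).congr_fun (fun t ht ↦ ?_) measurableSet_Iic,
    (integrableOn_exp_mul_Ioi (neg_neg_iff_pos.2 hδ) 0).congr_fun (fun t ht ↦ ?_) measurableSet_Ioi⟩
  · simp only [abs_of_nonpos (Set.mem_Iic.1 ht)]; ring_nf
  · simp only [abs_of_pos (Set.mem_Ioi.1 ht)]

theorem integrable_vertical_of_norm_le_exp {f : ℂ → ℂ} {σ C δ : ℝ} (hδ : 0 < δ)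
    (hc : Continuous fun t : ℝ ↦ f (σ + t * I))
    (hb : ∀ t : ℝ, ‖f (σ + t * I)‖ ≤ C * Real.exp (-δ * |t|)) :
    Integrable fun t : ℝ ↦ f (σ + t * I) :=
  ((integrable_exp_neg_mul_abs hδ).const_mul C).mono' hc.aestronglyMeasurable
    (ae_of_all _ hb)

theorem DifferentiableOn.continuous_vertical {f : ℂ → ℂ} {σ σ₁ σ₂ : ℝ}
    (hd : DifferentiableOn ℂ f {z | z.re ∈ Set.Icc σ₁ σ₂}) (hσ : σ ∈ Set.Icc σ₁ σ₂) :
    Continuous fun t : ℝ ↦ f (σ + t * I) :=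
  hd.continuousOn.comp_continuous (by fun_prop) fun t ↦ by simpa using hσ

/-- Shifting a vertical contour of integration inside a strip of holomorphy. -/
theorem integral_vertical_eq_of_norm_le_exp {f : ℂ → ℂ} {σ₁ σ₂ C δ : ℝ} (hσ : σ₁ ≤ σ₂)
    (hδ : 0 < δ) (hd : DifferentiableOn ℂ f {z | z.re ∈ Set.Icc σ₁ σ₂})
    (hb : ∀ z : ℂ, z.re ∈ Set.Icc σ₁ σ₂ → ‖f z‖ ≤ C * Real.exp (-δ * |z.im|)) :
    ∫ t : ℝ, f (σ₁ + t * I) = ∫ t : ℝ, f (σ₂ + t * I) := by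
  have hint {σ : ℝ} (h : σ ∈ Set.Icc σ₁ σ₂) : Integrable fun t : ℝ ↦ f (σ + t * I) :=
    integrable_vertical_of_norm_le_exp hδ (hd.continuous_vertical h) fun t ↦ by
      simpa using hb (σ + t * I) (by simpa using h)
  have htend {σ : ℝ} (h : σ ∈ Set.Icc σ₁ σ₂) :
      Tendsto (fun T : ℝ ↦ ∫ t in (-T)..T, f (σ + t * I)) atTop (nhds (∫ t : ℝ, f (σ + t * I))) :=
    intervalIntegral_tendsto_integral (hint h) tendsto_neg_atTop_atBot tendsto_id
  have hhor (c : ℝ) (hc : |c| = 1) :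
      Tendsto (fun T : ℝ ↦ ∫ x in σ₁..σ₂, f (x + (c * T : ℝ) * I)) atTop (nhds 0) := by
    have hlim : Tendsto (fun T : ℝ ↦ C * Real.exp (-δ * T) * |σ₂ - σ₁|) atTop (nhds 0) := by
      have h1 : Tendsto (fun T : ℝ ↦ -δ * T) atTop atBot :=
        tendsto_id.const_mul_atTop_of_neg (by linarith)
      simpa using ((Real.tendsto_exp_atBot.comp h1).const_mul C).mul_const |σ₂ - σ₁|
    refine squeeze_zero_norm' ?_ hlim
    filter_upwards [eventually_ge_atTop 0] with T hT
    refine intervalIntegral.norm_integral_le_of_norm_le_const fun x hx ↦ ?_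
    rw [Set.uIoc_of_le hσ] at hx
    have := hb (x + (c * T : ℝ) * I) (by simpa using ⟨hx.1.le, hx.2⟩)
    simpa [abs_mul, hc, abs_of_nonneg hT] using this
  have hrect (T : ℝ) := Complex.integral_boundary_rect_eq_zero_of_differentiableOn f
    (σ₁ + (-T : ℝ) * I) (σ₂ + T * I) (hd.mono fun z hz ↦ by
      have := hz.1
      simpa [Set.uIcc_of_le hσ] using this)
  have h1 := htend (Set.left_mem_Icc.2 hσ)
  have h2 := htend (Set.right_mem_Icc.2 hσ)
  have h3 := ((((hhor (-1) (by simp)).sub (hhor 1 (by simp))).add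
    (h2.const_smul I)).sub (h1.const_smul I))
  have h4 := tendsto_nhds_unique h3 (tendsto_const_nhds (x := (0 : ℂ)) |>.congr fun T ↦ by
    have := hrect T
    simp at this ⊢
    exact this.symm)
  simp only [sub_self, zero_add, smul_eq_mul, ← mul_sub, mul_eq_zero, I_ne_zero, false_or] at h4
  exact (sub_eq_zero.1 h4).symm

theorem Real.Gamma_add_le_Gamma_mul_rpow {x β : ℝ} (hx : 0 < x) (h0 : 0 ≤ β) (h1 : β ≤ 1) :
    Real.Gamma (x + β) ≤ Real.Gamma x * x ^ β := by
  rcases h0.eq_or_lt with rfl | h0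
  · simp
  rcases h1.eq_or_lt with rfl | h1
  · rw [Real.Gamma_add_one hx.ne', Real.rpow_one, mul_comm]
  have h := Real.Gamma_mul_add_mul_le_rpow_Gamma_mul_rpow_Gamma hx (add_pos hx one_pos)
    (sub_pos.2 h1) h0 (sub_add_cancel 1 β)
  have hG := Real.Gamma_pos_of_pos hx
  calc Real.Gamma (x + β) = Real.Gamma ((1 - β) * x + β * (x + 1)) := by ring_nf
    _ ≤ _ := h
    _ = (Real.Gamma x ^ (1 - β) * Real.Gamma x ^ β) * x ^ β := by
      rw [Real.Gamma_add_one hx.ne', Real.mul_rpow hx.le hG.le]; ring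
    _ = _ := by rw [← Real.rpow_add hG, sub_add_cancel, Real.rpow_one]

theorem Real.Gamma_add_div_Gamma_isTheta {β : ℝ} (hβ : 0 ≤ β) :
    (fun x : ℝ ↦ Real.Gamma (x + β) / Real.Gamma x) =Θ[atTop] fun x ↦ x ^ β := by
  obtain ⟨n, hn⟩ := exists_nat_ge β
  induction n generalizing β with
  | zero =>
    obtain rfl : β = 0 := le_antisymm (by simpa using hn) hβ
    refine EventuallyEq.isTheta ?_
    filter_upwards [eventually_gt_atTop 0] with x hx
    have := Real.Gamma_pos_of_pos hx
    simp [this.ne']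
  | succ n ih =>
    rcases le_or_gt β 1 with h1 | h1
    · refine ⟨Asymptotics.IsBigO.of_bound 1 ?_, Asymptotics.IsBigO.of_bound 2 ?_⟩ <;>
        filter_upwards [eventually_ge_atTop 1] with x hx
      · have hx0 : 0 < x := by linarith
        have hG := Real.Gamma_pos_of_pos hx0
        have hG' := Real.Gamma_pos_of_pos (by linarith : 0 < x + β)
        rw [Real.norm_of_nonneg (by positivity), Real.norm_of_nonneg (by positivity), one_mul,
          div_le_iff₀ hG, mul_comm]
        exact Real.Gamma_add_le_Gamma_mul_rpow hx0 hβ h1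
      · have hx0 : 0 < x := by linarith
        have hG := Real.Gamma_pos_of_pos hx0
        have hG' := Real.Gamma_pos_of_pos (by linarith : 0 < x + β)
        rw [Real.norm_of_nonneg (by positivity), Real.norm_of_nonneg (by positivity),
          ← mul_div_assoc, le_div_iff₀ hG]
        have h := Real.Gamma_add_le_Gamma_mul_rpow (by linarith : 0 < x + β) (sub_nonneg.2 h1)
          (by linarith : 1 - β ≤ 1)
        rw [add_add_sub_cancel, Real.Gamma_add_one hx0.ne'] at h
        have h2 : (x + β) ^ (1 - β) ≤ 2 * x ^ (1 - β) := by
          calc (x + β) ^ (1 - β) ≤ (2 * x) ^ (1 - β) := by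
                refine Real.rpow_le_rpow (by linarith) (by linarith) (by linarith)
            _ = 2 ^ (1 - β) * x ^ (1 - β) := Real.mul_rpow two_pos.le hx0.le
            _ ≤ 2 ^ (1 : ℝ) * x ^ (1 - β) := by
                gcongr
                · norm_num
                · linarith
            _ = _ := by rw [Real.rpow_one]
        have h3 : x ^ β * x ^ (1 - β) = x := by
          rw [← Real.rpow_add hx0, add_sub_cancel, Real.rpow_one]
        refine le_of_mul_le_mul_right ?_ (Real.rpow_pos_of_pos hx0 (1 - β))
        calc x ^ β * Real.Gamma x * x ^ (1 - β) = (x ^ β * x ^ (1 - β)) * Real.Gamma x := by ring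
          _ ≤ Real.Gamma (x + β) * (x + β) ^ (1 - β) := by rw [h3]; exact h
          _ ≤ Real.Gamma (x + β) * (2 * x ^ (1 - β)) := by gcongr
          _ = _ := by ring
    · have h := ih (β := β - 1) (by linarith) (by push_cast at hn; linarith)
      have hlin : (fun x : ℝ ↦ x + (β - 1)) =Θ[atTop] fun x ↦ x :=
        Asymptotics.isTheta_rfl.add_isLittleO (Asymptotics.isLittleO_const_id_atTop (β - 1))
      refine EventuallyEq.trans_isTheta ?_ ((hlin.mul h).trans_eventuallyEq ?_)
      · filter_upwards [eventually_gt_atTop 0] with x hx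
        rw [← mul_div_assoc, ← Real.Gamma_add_one (by linarith : x + (β - 1) ≠ 0)]
        ring_nf
      · filter_upwards [eventually_gt_atTop 0] with x hx
        rw [← Real.rpow_one_add' hx.le (by linarith), add_sub_cancel]

theorem mellin_eq_of_mellinInv {σ : ℝ} {F : ℂ → ℂ} {f : ℝ → ℂ}
    (hf : ∀ x > 0, f x = mellinInv σ F x) (hc : Continuous fun y : ℝ ↦ F (σ + y * I))
    (hF : Integrable fun y : ℝ ↦ F (σ + y * I)) (hm : MellinConvergent f σ) :
    mellin f σ = F σ := by
  let h : ℝ → ℂ := fun y ↦ F (σ + 2 * π * y * I)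
  have h2π : 2 * π ≠ 0 := by simp
  have hh : h = fun y : ℝ ↦ F (σ + (2 * π * y : ℝ) * I) := by simp [h]
  have hhc : Continuous h := by
    rw [hh]; exact hc.comp (continuous_const.mul continuous_id)
  have hhi : Integrable h := by
    rw [hh]; exact hF.comp_mul_left' h2π
  let g : ℝ → ℂ := fun u ↦ Real.exp (-σ * u) • f (Real.exp (-u))
  have hg : g = FourierTransformInv.fourierInv h := by
    ext u
    simp only [g]
    rw [hf _ (Real.exp_pos _), mellinInv_eq_fourierInv _ _ (Real.exp_pos _), Real.log_exp, neg_neg,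
      ← Complex.ofReal_neg, ← Complex.ofReal_cpow (Real.exp_pos _).le, ← Real.exp_mul]
    simp only [Complex.real_smul, smul_eq_mul]
    rw [← mul_assoc, ← Complex.ofReal_mul, ← Real.exp_add]
    have : -σ * u + -u * -σ = 0 := by ring
    rw [this]
    simp [h]
  have hgi : Integrable g := by
    have hderiv : ∀ x ∈ Set.univ, HasDerivWithinAt (fun u ↦ Real.exp (-u)) (-Real.exp (-x))
        Set.univ x := fun x _ ↦ by
      simpa only [mul_neg, mul_one] using (hasDerivAt_neg x).exp.hasDerivWithinAt
    have himg : (fun u : ℝ ↦ Real.exp (-u)) '' Set.univ = Set.Ioi 0 := by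
      ext x
      simp only [Set.image_univ, Set.mem_range, Set.mem_Ioi]
      exact ⟨fun ⟨u, hu⟩ ↦ hu ▸ Real.exp_pos _, fun hx ↦ ⟨-Real.log x, by simp [Real.exp_log hx]⟩⟩
    have hinj : Set.univ.InjOn fun u : ℝ ↦ Real.exp (-u) := fun x _ y _ hxy ↦ by simpa using hxy
    rw [MellinConvergent, ← himg, integrableOn_image_iff_integrableOn_abs_deriv_smul
      MeasurableSet.univ hderiv hinj, integrableOn_univ] at hm
    refine hm.congr (ae_of_all _ fun u ↦ ?_)
    simp only [g]
    have h1 : (Real.exp (-u) : ℂ) ^ ((σ : ℂ) - 1) = (Real.exp (-u * (σ - 1)) : ℝ) := by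
      rw [← Complex.ofReal_one, ← Complex.ofReal_sub, ← Complex.ofReal_cpow (Real.exp_pos _).le,
        ← Real.exp_mul]
    rw [h1, abs_neg, abs_of_pos (Real.exp_pos _), Complex.real_smul, Complex.real_smul, smul_eq_mul,
      ← mul_assoc, ← Complex.ofReal_mul, ← Real.exp_add]
    ring_nf
  have hmain := mellin_eq_fourier f (s := (σ : ℂ))
  rw [hg] at hgi
  have hFi : Integrable (FourierTransform.fourier h) := by
    refine hgi.comp_neg.congr (ae_of_all _ fun y ↦ ?_)
    simp only [Real.fourierInv_eq_fourier_neg, neg_neg]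
  have hinv := hhi.fourier_fourierInv_eq hFi (v := 0) hhc.continuousAt
  rw [hmain]
  simp only [Complex.ofReal_re, Complex.ofReal_im, zero_div]
  change FourierTransform.fourier g 0 = _
  rw [hg, hinv]
  simp [h]

section Kernel

variable {m p : ℕ} {a α b β : ℕ → ℝ}

theorem foxKernelM_eq_prod_mul_prod_inv (s : ℂ) :
    foxKernelM m p a α b β s = (∏ j ∈ Finset.range m, Complex.Gamma (b j + β j * s)) *
      ∏ i ∈ Finset.range p, (Complex.Gamma (a i + α i * s))⁻¹ := by
  rw [foxKernelM, div_eq_mul_inv, Finset.prod_inv_distrib]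

theorem foxKernelM_differentiableAt (hβ : ∀ j < m, 0 < β j) {σ : ℝ}
    (hσ : ∀ j < m, 0 < b j + β j * σ) {s : ℂ} (hs : σ ≤ s.re) :
    DifferentiableAt ℂ (foxKernelM m p a α b β) s := by
  rw [funext foxKernelM_eq_prod_mul_prod_inv]
  refine .mul (.fun_finsetProd fun j hj ↦ ?_) (.fun_finsetProd fun i _ ↦ ?_)
  · have hj := Finset.mem_range.1 hj
    refine DifferentiableAt.comp (g := Complex.Gamma) s
      (Complex.differentiableAt_Gamma _ fun n h ↦ ?_) (by fun_prop)
    have hre := congrArg Complex.re h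
    simp at hre
    have h1 := mul_le_mul_of_nonneg_left hs (hβ j hj).le
    linarith [hσ j hj, (n.cast_nonneg : (0 : ℝ) ≤ n)]
  · exact (Complex.differentiable_one_div_Gamma _).comp s (by fun_prop)

theorem foxKernelM_exists_norm_le_exp (hα : ∀ i < p, 0 < α i) (hβ : ∀ j < m, 0 < β j)
    (hΔ : 0 < ∑ j ∈ Finset.range m, β j - ∑ i ∈ Finset.range p, α i)
    {σ₁ : ℝ} (hσ : ∀ j < m, 0 < b j + β j * σ₁) (σ₂ : ℝ) :
    ∃ C δ, 0 < δ ∧ ∀ s : ℂ, s.re ∈ Set.Icc σ₁ σ₂ →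
      ‖foxKernelM m p a α b β s‖ ≤ C * Real.exp (-δ * |s.im|) := by
  set B := ∑ j ∈ Finset.range m, β j
  set A := ∑ i ∈ Finset.range p, α i
  obtain ⟨θ, hθ, hδ⟩ : ∃ θ < π / 2, 0 < θ * B - (π - θ) * A := by
    have hlim : Tendsto (fun θ : ℝ ↦ θ * B - (π - θ) * A) (nhdsWithin (π / 2) (Set.Iio (π / 2)))
        (nhds (π / 2 * B - (π - π / 2) * A)) :=
      (Continuous.tendsto (by fun_prop) _).mono_left nhdsWithin_le_nhds
    have hpos : 0 < π / 2 * B - (π - π / 2) * A := by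
      have := mul_pos (half_pos pi_pos) hΔ
      linarith
    exact ((eventually_mem_nhdsWithin.and (hlim.eventually_const_lt hpos)).exists)
  have hnum : ∀ j, ∃ C, j < m → ∀ s : ℂ, s.re ∈ Set.Icc σ₁ σ₂ →
      ‖Complex.Gamma (b j + β j * s)‖ ≤ C * Real.exp (-θ * (β j * |s.im|)) := fun j ↦ by
    by_cases hj : j < m
    · obtain ⟨C, -, hC⟩ := Complex.exists_norm_Gamma_le_exp (σ₂ := b j + β j * σ₂) hθ (hσ j hj)
      refine ⟨C, fun _ s hs ↦ ?_⟩
      have := hC (b j + β j * s) (by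
        have := hβ j hj
        simpa [this] using hs)
      simpa [abs_mul, abs_of_pos (hβ j hj)] using this
    · exact ⟨0, fun h ↦ absurd h hj⟩
  have hden : ∀ i, ∃ C, i < p → ∀ s : ℂ, s.re ∈ Set.Icc σ₁ σ₂ →
      ‖(Complex.Gamma (a i + α i * s))⁻¹‖ ≤ C * Real.exp ((π - θ) * (α i * |s.im|)) := fun i ↦ by
    by_cases hi : i < p
    · obtain ⟨C, -, hC⟩ := Complex.exists_norm_inv_Gamma_le_exp hθ (a i + α i * σ₁)
        (a i + α i * σ₂)
      refine ⟨C, fun _ s hs ↦ ?_⟩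
      have := hC (a i + α i * s) (by
        have := hα i hi
        simpa [this] using hs)
      simpa only [Complex.add_im, Complex.ofReal_im, zero_add, Complex.im_ofReal_mul, abs_mul,
        abs_of_pos (hα i hi)] using this
    · exact ⟨0, fun h ↦ absurd h hi⟩
  choose C hC using hnum
  choose D hD using hden
  refine ⟨(∏ j ∈ Finset.range m, C j) * ∏ i ∈ Finset.range p, D i, _, hδ, fun s hs ↦ ?_⟩
  rw [foxKernelM_eq_prod_mul_prod_inv, norm_mul, norm_prod, norm_prod]
  calc _ ≤ (∏ j ∈ Finset.range m, C j * Real.exp (-θ * (β j * |s.im|))) *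
        ∏ i ∈ Finset.range p, D i * Real.exp ((π - θ) * (α i * |s.im|)) := by
        have h1 := Finset.prod_le_prod (fun j _ ↦ norm_nonneg _)
          fun j hj ↦ hC j (Finset.mem_range.1 hj) s hs
        have h2 := Finset.prod_le_prod (fun i _ ↦ norm_nonneg _)
          fun i hi ↦ hD i (Finset.mem_range.1 hi) s hs
        exact mul_le_mul h1 h2 (Finset.prod_nonneg fun _ _ ↦ norm_nonneg _)
          ((Finset.prod_nonneg fun _ _ ↦ norm_nonneg _).trans h1)
    _ = _ := by
        rw [Finset.prod_mul_distrib, Finset.prod_mul_distrib, mul_mul_mul_comm, ← Real.exp_sum,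
          ← Real.exp_sum, ← Real.exp_add, ← Finset.mul_sum, ← Finset.mul_sum, ← Finset.sum_mul,
          ← Finset.sum_mul]
        congr 2
        ring

theorem foxKernelM_continuous_vertical (hβ : ∀ j < m, 0 < β j) {σ : ℝ}
    (hσ : ∀ j < m, 0 < b j + β j * σ) :
    Continuous fun t : ℝ ↦ foxKernelM m p a α b β (σ + t * I) :=
  continuous_iff_continuousAt.2 fun t ↦ ContinuousAt.comp
    (foxKernelM_differentiableAt hβ hσ (by simp)).continuousAt (by fun_prop)

theorem foxKernelM_integrable_vertical (hα : ∀ i < p, 0 < α i) (hβ : ∀ j < m, 0 < β j)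
    (hΔ : 0 < ∑ j ∈ Finset.range m, β j - ∑ i ∈ Finset.range p, α i)
    {σ : ℝ} (hσ : ∀ j < m, 0 < b j + β j * σ) :
    Integrable fun t : ℝ ↦ foxKernelM m p a α b β (σ + t * I) := by
  obtain ⟨C, δ, hδ, h⟩ := foxKernelM_exists_norm_le_exp (a := a) hα hβ hΔ hσ σ
  exact integrable_vertical_of_norm_le_exp hδ (foxKernelM_continuous_vertical hβ hσ)
    fun t ↦ by simpa using h (σ + t * I) (by simp)

theorem foxHposM_eq_of_le (hα : ∀ i < p, 0 < α i) (hβ : ∀ j < m, 0 < β j)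
    (hΔ : 0 < ∑ j ∈ Finset.range m, β j - ∑ i ∈ Finset.range p, α i)
    {σ₁ σ₂ : ℝ} (hσ : ∀ j < m, 0 < b j + β j * σ₁) (hle : σ₁ ≤ σ₂) (x : ℝ) :
    foxHposM m p a α b β σ₁ x = foxHposM m p a α b β σ₂ x := by
  obtain ⟨C, δ, hδ, h⟩ := foxKernelM_exists_norm_le_exp (a := a) hα hβ hΔ hσ σ₂
  rw [foxHposM, foxHposM]
  congr 1
  obtain ⟨M, hM⟩ := (isCompact_Icc (a := σ₁) (b := σ₂)).exists_bound_of_continuousOn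
    (f := fun σ ↦ Real.exp (-σ * Real.log x)) (by fun_prop)
  refine integral_vertical_eq_of_norm_le_exp
    (f := fun s ↦ foxKernelM m p a α b β s * Complex.exp (-s * (Real.log x : ℂ)))
    (C := C * M) hle hδ (fun s hs ↦ ?_) (fun s hs ↦ ?_)
  · exact ((foxKernelM_differentiableAt hβ hσ hs.1).mul (by fun_prop)).differentiableWithinAt
  · have h1 := hM _ hs
    rw [Real.norm_of_nonneg (Real.exp_pos _).le] at h1
    rw [norm_mul, Complex.norm_exp, mul_right_comm]
    refine mul_le_mul (h s hs) ?_ (Real.exp_pos _).le ((norm_nonneg _).trans (h s hs))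
    simpa using h1

theorem foxHposM_eq (hα : ∀ i < p, 0 < α i) (hβ : ∀ j < m, 0 < β j)
    (hΔ : 0 < ∑ j ∈ Finset.range m, β j - ∑ i ∈ Finset.range p, α i)
    {σ₁ σ₂ : ℝ} (h₁ : ∀ j < m, 0 < b j + β j * σ₁) (h₂ : ∀ j < m, 0 < b j + β j * σ₂) (x : ℝ) :
    foxHposM m p a α b β σ₁ x = foxHposM m p a α b β σ₂ x := by
  rcases le_total σ₁ σ₂ with h | h
  · exact foxHposM_eq_of_le hα hβ hΔ h₁ h x
  · exact (foxHposM_eq_of_le hα hβ hΔ h₂ h x).symm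

theorem foxHposM_eq_mellinInv (γ : ℝ) {x : ℝ} (hx : 0 < x) :
    foxHposM m p a α b β γ x = mellinInv γ (foxKernelM m p a α b β) x := by
  have hx' : (x : ℂ) ≠ 0 := by exact_mod_cast hx.ne'
  rw [foxHposM, mellinInv, Complex.real_smul]
  congr 1
  · push_cast
    rfl
  refine integral_congr_ae (ae_of_all _ fun t ↦ ?_)
  simp only
  rw [Complex.cpow_def_of_ne_zero hx', smul_eq_mul, Complex.ofReal_log hx.le]
  ring_nf

theorem norm_foxHposM_le (γ : ℝ) {x : ℝ} (hx : 0 < x) :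
    ‖foxHposM m p a α b β γ x‖ ≤
      1 / (2 * π) * (∫ t : ℝ, ‖foxKernelM m p a α b β (γ + t * I)‖) * x ^ (-γ) := by
  rw [foxHposM, norm_mul, mul_assoc, ← integral_mul_const]
  have h : ‖(1 / (2 * π) : ℂ)‖ = 1 / (2 * π) := by
    have : (1 / (2 * π) : ℂ) = ((1 / (2 * π) : ℝ) : ℂ) := by push_cast; ring
    rw [this, Complex.norm_real, Real.norm_of_nonneg (by positivity)]
  rw [h]
  gcongr
  refine (norm_integral_le_integral_norm _).trans_eq (integral_congr_ae (ae_of_all _ fun t ↦ ?_))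
  simp only [norm_mul, Complex.norm_exp]
  rw [Real.rpow_def_of_pos hx]
  congr 2
  simp
  ring

theorem foxHposM_continuousOn (hα : ∀ i < p, 0 < α i) (hβ : ∀ j < m, 0 < β j)
    (hΔ : 0 < ∑ j ∈ Finset.range m, β j - ∑ i ∈ Finset.range p, α i)
    {γ : ℝ} (hγ : ∀ j < m, 0 < b j + β j * γ) :
    ContinuousOn (foxHposM m p a α b β γ) (Set.Ioi 0) := by
  have hcont : Continuous fun u : ℝ ↦ ∫ t : ℝ, foxKernelM m p a α b β (γ + t * I) *
      Complex.exp (-(t * I) * u) := by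
    have hk := foxKernelM_integrable_vertical (a := a) hα hβ hΔ hγ
    refine continuous_of_dominated (fun u ↦ ?_) (fun u ↦ ae_of_all _ fun t ↦ ?_) hk.norm
      (ae_of_all _ fun t ↦ by fun_prop)
    · exact hk.aestronglyMeasurable.mul (Continuous.aestronglyMeasurable (by fun_prop))
    · simp [Complex.norm_exp]
  have heq : foxHposM m p a α b β γ = fun x ↦ (1 / (2 * π)) *
      (Complex.exp (-γ * (Real.log x : ℂ)) *
        ∫ t : ℝ, foxKernelM m p a α b β (γ + t * I) * Complex.exp (-(t * I) * Real.log x)) := by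
    ext x
    rw [foxHposM]
    congr 1
    rw [← integral_const_mul]
    refine integral_congr_ae (ae_of_all _ fun t ↦ ?_)
    simp only
    rw [mul_left_comm, ← Complex.exp_add]
    ring_nf
  have hlog : ContinuousOn Real.log (Set.Ioi 0) :=
    Real.continuousOn_log.mono fun x hx ↦ (Set.mem_Ioi.1 hx).ne'
  rw [heq]
  exact continuousOn_const.mul (.mul (Continuous.comp_continuousOn'
    (g := fun u : ℝ ↦ Complex.exp (-γ * (u : ℂ))) (by fun_prop) hlog) (hcont.comp_continuousOn hlog))

theorem foxHposM_mellinConvergent (hα : ∀ i < p, 0 < α i) (hβ : ∀ j < m, 0 < β j)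
    (hΔ : 0 < ∑ j ∈ Finset.range m, β j - ∑ i ∈ Finset.range p, α i)
    {γ σ : ℝ} (hγ : ∀ j < m, 0 < b j + β j * γ) (hσ : ∀ j < m, 0 < b j + β j * σ) :
    MellinConvergent (foxHposM m p a α b β γ) σ := by
  obtain ⟨τ, hτσ, hτ⟩ : ∃ τ < σ, ∀ j < m, 0 < b j + β j * τ := by
    have h : ∀ᶠ τ in nhdsWithin σ (Set.Iio σ), ∀ j ∈ Finset.range m, 0 < b j + β j * τ :=
      (Filter.eventually_all_finset _).2 fun j hj ↦
        ((Continuous.tendsto (f := fun τ ↦ b j + β j * τ) (by fun_prop) σ).mono_left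
          nhdsWithin_le_nhds).eventually_const_lt (hσ j (Finset.mem_range.1 hj))
    obtain ⟨τ, h1, h2⟩ := (eventually_mem_nhdsWithin.and h).exists
    exact ⟨τ, h1, fun j hj ↦ h2 j (Finset.mem_range.2 hj)⟩
  have hτ' : ∀ j < m, 0 < b j + β j * (σ + 1) := fun j hj ↦ by
    linarith [hσ j hj, hβ j hj]
  have hO {ν : ℝ} (hν : ∀ j < m, 0 < b j + β j * ν) {l : Filter ℝ} (hl : ∀ᶠ x in l, 0 < x) :
      foxHposM m p a α b β γ =O[l] fun x ↦ x ^ (-ν) := by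
    refine Asymptotics.IsBigO.of_bound
      (1 / (2 * π) * ∫ t : ℝ, ‖foxKernelM m p a α b β (ν + t * I)‖) ?_
    filter_upwards [hl] with x hx
    rw [foxHposM_eq hα hβ hΔ hγ hν, Real.norm_of_nonneg (Real.rpow_nonneg hx.le _)]
    exact norm_foxHposM_le ν hx
  exact mellinConvergent_of_isBigO_rpow (a := σ + 1) (b := τ)
    ((foxHposM_continuousOn hα hβ hΔ hγ).locallyIntegrableOn measurableSet_Ioi)
    (hO hτ' (eventually_gt_atTop 0)) (by simp) (hO hτ self_mem_nhdsWithin) (by simpa)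

theorem mellin_foxHposM (hα : ∀ i < p, 0 < α i) (hβ : ∀ j < m, 0 < β j)
    (hΔ : 0 < ∑ j ∈ Finset.range m, β j - ∑ i ∈ Finset.range p, α i)
    {γ σ : ℝ} (hγ : ∀ j < m, 0 < b j + β j * γ) (hσ : ∀ j < m, 0 < b j + β j * σ) :
    mellin (foxHposM m p a α b β γ) σ = foxKernelM m p a α b β σ :=
  mellin_eq_of_mellinInv
    (fun x hx ↦ by rw [foxHposM_eq hα hβ hΔ hγ hσ, foxHposM_eq_mellinInv σ hx])
    (foxKernelM_continuous_vertical hβ hσ) (foxKernelM_integrable_vertical hα hβ hΔ hσ)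
    (foxHposM_mellinConvergent hα hβ hΔ hγ hσ)

theorem foxKernelM_ofReal (x : ℝ) :
    foxKernelM m p a α b β x = (((∏ j ∈ Finset.range m, Real.Gamma (b j + β j * x)) /
      ∏ i ∈ Finset.range p, Real.Gamma (a i + α i * x) : ℝ) : ℂ) := by
  rw [foxKernelM]
  push_cast [← Complex.Gamma_ofReal]
  rfl

end Kernel

theorem Real.Gamma_ratio_isTheta (b : ℝ) {β : ℝ} (hβ : 0 < β) :
    (fun k : ℕ ↦ Real.Gamma (b + β * (1 + (k + 1 : ℕ))) / Real.Gamma (b + β * (1 + k)))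
      =Θ[atTop] fun k ↦ (k : ℝ) ^ β := by
  have hlim : Tendsto (fun k : ℕ ↦ b + β * (1 + k)) atTop atTop :=
    tendsto_atTop_add_const_left _ _ ((tendsto_atTop_add_const_left _ _
      tendsto_natCast_atTop_atTop).const_mul_atTop hβ)
  have h0 := Real.Gamma_add_div_Gamma_isTheta hβ.le
  have h1 : (_ ∘ _) =Θ[atTop] (_ ∘ _) := ⟨h0.1.comp_tendsto hlim, h0.2.comp_tendsto hlim⟩
  have h2 : (fun k : ℕ ↦ b + β * (1 + k)) =Θ[atTop] fun k ↦ (k : ℝ) := by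
    have : (fun k : ℕ ↦ b + β * (1 + k)) = fun k : ℕ ↦ β * k + (b + β) := by ext; ring
    rw [this]
    refine Asymptotics.IsTheta.add_isLittleO
      ((Asymptotics.isTheta_const_mul_left hβ.ne').2 Asymptotics.isTheta_rfl) ?_
    exact (Asymptotics.isLittleO_const_id_atTop (b + β)).comp_tendsto tendsto_natCast_atTop_atTop
  have h3 : (fun k : ℕ ↦ (b + β * (1 + k)) ^ β) =Θ[atTop] fun k ↦ (k : ℝ) ^ β :=
    ⟨h2.1.rpow hβ.le (Eventually.of_forall fun k ↦ k.cast_nonneg),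
      h2.2.rpow hβ.le (hlim.eventually_ge_atTop 0)⟩
  refine Asymptotics.IsTheta.trans (EventuallyEq.trans_isTheta
    (Eventually.of_forall fun k ↦ ?_) h1) h3
  simp only [Function.comp]
  push_cast
  ring_nf

theorem Asymptotics.IsTheta.finsetProd_rpow {ι : Type*} {s : Finset ι} {f : ι → ℕ → ℝ} {e : ι → ℝ}
    (h : ∀ i ∈ s, f i =Θ[atTop] fun k ↦ (k : ℝ) ^ e i) :
    (fun k ↦ ∏ i ∈ s, f i k) =Θ[atTop] fun k ↦ (k : ℝ) ^ ∑ i ∈ s, e i := by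
  classical
  induction s using Finset.induction_on with
  | empty => simp
  | insert i s hi ih =>
    simp only [Finset.prod_insert hi, Finset.sum_insert hi]
    refine ((h i (by simp)).mul (ih fun j hj ↦ h j (by simp [hj]))).trans_eventuallyEq ?_
    filter_upwards [eventually_gt_atTop 0] with k hk
    rw [Real.rpow_add (by exact_mod_cast hk)]

theorem summable_wright {m p : ℕ} {a α b β : ℕ → ℝ}
    (hα : ∀ i < p, 0 < α i) (hβ : ∀ j < m, 0 < β j)
    (hb : ∀ j < m, 0 < b j + β j) (ha : ∀ i < p, 0 < a i + α i)
    (hΔ : ∑ j ∈ Finset.range m, β j - ∑ i ∈ Finset.range p, α i < 1) (r : ℝ) :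
    Summable fun k : ℕ ↦ (∏ j ∈ Finset.range m, Real.Gamma (b j + β j * (1 + k))) /
      (∏ i ∈ Finset.range p, Real.Gamma (a i + α i * (1 + k))) * r ^ k / k.factorial := by
  rcases eq_or_ne r 0 with rfl | hr
  · refine summable_of_ne_finset_zero (s := {0}) fun k hk ↦ ?_
    simp [zero_pow (by simpa using hk : k ≠ 0)]
  set N : ℕ → ℝ := fun k ↦ ∏ j ∈ Finset.range m, Real.Gamma (b j + β j * (1 + k))
  set D : ℕ → ℝ := fun k ↦ ∏ i ∈ Finset.range p, Real.Gamma (a i + α i * (1 + k))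
  change Summable fun k : ℕ ↦ N k / D k * r ^ k / k.factorial
  have hN (k : ℕ) : 0 < N k := Finset.prod_pos fun j hj ↦ Real.Gamma_pos_of_pos (by
    have hj := Finset.mem_range.1 hj
    nlinarith [hβ j hj, hb j hj, (k.cast_nonneg : (0 : ℝ) ≤ k)])
  have hD (k : ℕ) : 0 < D k := Finset.prod_pos fun i hi ↦ Real.Gamma_pos_of_pos (by
    have hi := Finset.mem_range.1 hi
    nlinarith [hα i hi, ha i hi, (k.cast_nonneg : (0 : ℝ) ≤ k)])
  have hNr : (fun k ↦ N (k + 1) / N k) =Θ[atTop] fun k ↦ (k : ℝ) ^ ∑ j ∈ Finset.range m, β j := by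
    simp only [N, ← Finset.prod_div_distrib]
    exact .finsetProd_rpow fun j hj ↦ Real.Gamma_ratio_isTheta _ (hβ j (Finset.mem_range.1 hj))
  have hDr : (fun k ↦ D (k + 1) / D k) =Θ[atTop] fun k ↦ (k : ℝ) ^ ∑ i ∈ Finset.range p, α i := by
    simp only [D, ← Finset.prod_div_distrib]
    exact .finsetProd_rpow fun i hi ↦ Real.Gamma_ratio_isTheta _ (hα i (Finset.mem_range.1 hi))
  refine summable_of_ratio_test_tendsto_lt_one one_pos (Eventually.of_forall fun k ↦ ?_) ?_
  · have := hN k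
    have := hD k
    positivity
  have hO : (fun k : ℕ ↦ (N (k + 1) / N k) / (D (k + 1) / D k) * (|r| * (k + 1 : ℝ)⁻¹)) =O[atTop]
      fun k ↦ (k : ℝ) ^ (-(1 - (∑ j ∈ Finset.range m, β j - ∑ i ∈ Finset.range p, α i))) := by
    have hinv : (fun k : ℕ ↦ |r| * (k + 1 : ℝ)⁻¹) =O[atTop] fun k : ℕ ↦ (k : ℝ)⁻¹ := by
      refine Asymptotics.IsBigO.of_bound |r| ?_
      filter_upwards [eventually_gt_atTop 0] with k hk
      have : (0 : ℝ) < k := by exact_mod_cast hk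
      rw [Real.norm_of_nonneg (by positivity), Real.norm_of_nonneg (by positivity)]
      gcongr
      linarith
    refine ((hNr.div hDr).1.mul hinv).trans_eventuallyEq ?_
    filter_upwards [eventually_gt_atTop 0] with k hk
    have : (0 : ℝ) < k := by exact_mod_cast hk
    rw [← Real.rpow_sub this, ← Real.rpow_neg_one, ← Real.rpow_add this]
    ring_nf
  have hlim := hO.trans_tendsto
    ((tendsto_rpow_neg_atTop (sub_pos.2 hΔ)).comp tendsto_natCast_atTop_atTop)
  refine hlim.congr fun k ↦ ?_
  have h1 := hN k
  have h2 := hD k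
  have h3 := hN (k + 1)
  have h4 := hD (k + 1)
  have h5 : 0 < |r| := abs_pos.2 hr
  simp only [norm_div, norm_mul, norm_pow, Real.norm_eq_abs, abs_of_pos h1, abs_of_pos h2,
    abs_of_pos h3, abs_of_pos h4, Nat.abs_cast, Nat.factorial_succ]
  push_cast
  field_simp
  ring

theorem integral_pow_mul_eq_mellin (f : ℝ → ℂ) (k : ℕ) :
    ∫ x in Set.Ioi (0 : ℝ), (x : ℂ) ^ k * f x = mellin f ((1 + k : ℝ) : ℂ) := by
  simp [mellin]

theorem integrableOn_pow_mul_of_mellinConvergent {f : ℝ → ℂ} {k : ℕ}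
    (h : MellinConvergent f ((1 + k : ℝ) : ℂ)) :
    IntegrableOn (fun x : ℝ ↦ (x : ℂ) ^ k * f x) (Set.Ioi 0) := by
  simpa [MellinConvergent] using h

/-- The Laplace transform of a nonnegative function is the exponential generating function of its
moments, provided that the latter converges absolutely. -/
theorem integral_exp_neg_mul_eq_tsum_moments {f : ℝ → ℂ} {M : ℕ → ℝ}
    (hf : ∀ x > 0, (f x).im = 0 ∧ 0 ≤ (f x).re)
    (hint : ∀ k : ℕ, IntegrableOn (fun x : ℝ ↦ (x : ℂ) ^ k * f x) (Set.Ioi 0))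
    (hM : ∀ k : ℕ, ∫ x in Set.Ioi (0 : ℝ), (x : ℂ) ^ k * f x = M k)
    {s : ℝ} (hs : 0 ≤ s) (hsum : Summable fun k ↦ M k * s ^ k / k.factorial) :
    ∫ x in Set.Ioi (0 : ℝ), Complex.exp (-(s : ℂ) * x) * f x =
      ∑' k : ℕ, (M k : ℂ) * (-(s : ℂ)) ^ k / k.factorial := by
  have hF (k : ℕ) (x : ℝ) : (-(s : ℂ) * x) ^ k / k.factorial * f x =
      (-(s : ℂ)) ^ k / k.factorial * ((x : ℂ) ^ k * f x) := by
    rw [mul_pow]; ring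
  have hnorm (k : ℕ) : ∫ x in Set.Ioi (0 : ℝ), ‖(x : ℂ) ^ k * f x‖ = M k := by
    rw [← Complex.ofReal_inj, ← hM k, ← integral_complex_ofReal]
    refine setIntegral_congr_fun measurableSet_Ioi fun x hx ↦ ?_
    obtain ⟨h1, h2⟩ := hf x hx
    have : f x = ((f x).re : ℂ) := Complex.ext rfl (by simpa using h1)
    rw [norm_mul, norm_pow, Complex.norm_real, Real.norm_of_nonneg (Set.mem_Ioi.1 hx).le, this,
      Complex.norm_real, Real.norm_of_nonneg h2]
    simp
  have key := hasSum_integral_of_summable_integral_norm (μ := volume.restrict (Set.Ioi (0 : ℝ)))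
    (F := fun (k : ℕ) (x : ℝ) ↦ (-(s : ℂ) * x) ^ k / k.factorial * f x)
    (fun k ↦ by simp only [hF]; exact (hint k).const_mul _) (by
      simp only [hF, norm_mul, integral_const_mul]
      refine hsum.congr fun k ↦ ?_
      have := hnorm k
      simp only [norm_mul] at this
      rw [this, norm_div, norm_pow, norm_neg, Complex.norm_real, Real.norm_of_nonneg hs,
        Complex.norm_natCast]
      ring)
  have hexp (x : ℝ) : ∑' k : ℕ, (-(s : ℂ) * x) ^ k / k.factorial * f x =
      Complex.exp (-(s : ℂ) * x) * f x := by
    rw [tsum_mul_right, Complex.exp_eq_exp_ℂ, NormedSpace.exp_eq_tsum_div]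
  simp only [hexp] at key
  rw [← key.tsum_eq]
  refine tsum_congr fun k ↦ ?_
  simp only [hF]
  rw [integral_const_mul, hM]
  ring

/-- for `0 < Δ < 1` the Laplace transform of the Fox-H density of type
`(m,0;p,m)` is the everywhere-convergent generalized Wright series. -/
theorem foxH_laplace_wright
    (m p : ℕ) (hm : 1 ≤ m)
    (a α b β : ℕ → ℝ)
    (hα : ∀ i < p, 0 < α i) (hβ : ∀ j < m, 0 < β j)
    (hb : ∀ j < m, 0 < b j + β j) (ha : ∀ i < p, 0 < a i + α i)
    (hΔpos : 0 < ∑ j ∈ Finset.range m, β j - ∑ i ∈ Finset.range p, α i)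
    (hΔlt : ∑ j ∈ Finset.range m, β j - ∑ i ∈ Finset.range p, α i < 1)
    (γ : ℝ) (hγ : ∀ j < m, -(b j) / β j < γ)
    (hH : ∀ x > (0 : ℝ), (foxHposM m p a α b β γ x).im = 0 ∧
      0 ≤ (foxHposM m p a α b β γ x).re)
    (K : ℝ)
    (hK : K = (∏ j ∈ Finset.range m, Real.Gamma (b j + β j)) /
      (∏ i ∈ Finset.range p, Real.Gamma (a i + α i))) :
    (∀ z : ℂ, Summable fun k : ℕ =>
      (((∏ j ∈ Finset.range m, Real.Gamma (b j + β j * (1 + k))) /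
        (∏ i ∈ Finset.range p, Real.Gamma (a i + α i * (1 + k)))) : ℂ) *
        z ^ k / (Nat.factorial k)) ∧
    ∀ s : ℝ, 0 ≤ s →
      (∫ x in Set.Ioi (0 : ℝ),
          Complex.exp (-(s : ℂ) * (x : ℂ)) * (foxHposM m p a α b β γ x / (K : ℂ))) =
        (1 / (K : ℂ)) * ∑' k : ℕ,
          (((∏ j ∈ Finset.range m, Real.Gamma (b j + β j * (1 + k))) /
            (∏ i ∈ Finset.range p, Real.Gamma (a i + α i * (1 + k)))) : ℂ) *
            (-(s : ℂ)) ^ k / (Nat.factorial k) := by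
  have hγ' : ∀ j < m, 0 < b j + β j * γ := fun j hj ↦ by
    have := (div_lt_iff₀ (hβ j hj)).1 (hγ j hj)
    linarith
  have hk (k : ℕ) : ∀ j < m, 0 < b j + β j * (1 + k) := fun j hj ↦ by
    nlinarith [hβ j hj, hb j hj, (k.cast_nonneg : (0 : ℝ) ≤ k)]
  have hsum := summable_wright hα hβ hb ha hΔlt
  have hmom (k : ℕ) := (integral_pow_mul_eq_mellin _ k).trans
    ((mellin_foxHposM (a := a) hα hβ hΔpos hγ' (hk k)).trans (foxKernelM_ofReal _))
  refine ⟨fun z ↦ ?_, fun s hs ↦ ?_⟩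
  · refine .of_norm ((hsum ‖z‖).norm.congr fun k ↦ ?_)
    simp
  · have h := integral_exp_neg_mul_eq_tsum_moments hH
      (fun k ↦ integrableOn_pow_mul_of_mellinConvergent
        (foxHposM_mellinConvergent hα hβ hΔpos hγ' (hk k))) hmom hs (hsum s)
    simp only [← mul_div_assoc]
    rw [integral_div, h, div_eq_mul_one_div, mul_comm]
    push_cast
    rfl
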